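/- arXiv:1603.09565 — 7 statements merged into one kernel-verified Lean document; each statement's English description precedes it below -/
import Mathlib

section
/- Let k be a field, ℓ ≥ m ≥ 1 integers, and C a k-linear subspace of the space k^{ℓ×m} of ℓ×m matrices over k. If there is an integer r with 1 ≤ r ≤ m such that every nonzero matrix in C has rank at least r, then the k-dimension of C is at most ℓ·(m − r + 1). -/
/-- A matrix whose first `s` columns vanish has rank at most `m - s`. -/
theorem Matrix.rank_le_sub_of_castLE_col_eq_zero {k : Type*} [Field k] {ℓ m s : ℕ} (hs : s ≤ m)
    (X : Matrix (Fin ℓ) (Fin m) k) (hX : ∀ i j, X i (Fin.castLE hs j) = 0) :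
    X.rank ≤ m - s := by
  classical
  rw [← Matrix.rank_transpose]
  refine (Matrix.rank_le_card_of_support_subset X.transpose
    (Finset.univ.image (Fin.castLE hs))ᶜ ?_).trans ?_
  · intro j hj
    contrapose! hj
    have hj : (j : ℕ) < s := by simpa using hj
    simpa [funext_iff] using fun i => hX i ⟨j, hj⟩
  · rw [Finset.card_compl, Finset.card_image_of_injective _ (Fin.castLE_injective hs)]
    simp

/-- **Singleton bound for rank metric codes.**
If every nonzero matrix in the linear rank metric code `C ≤ k^{ℓ×m}` (with `ℓ ≥ m ≥ 1`)
has rank at least `r` (with `1 ≤ r ≤ m`), then `dim_k C ≤ ℓ·(m − r + 1)`. -/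
theorem singleton_bound_rank_metric {k : Type*} [Field k] (ℓ m r : ℕ)
    (hm : 1 ≤ m) (hml : m ≤ ℓ) (hr1 : 1 ≤ r) (hrm : r ≤ m)
    (C : Submodule k (Matrix (Fin ℓ) (Fin m) k))
    (hC : ∀ X ∈ C, X ≠ 0 → r ≤ X.rank) :
    Module.finrank k C ≤ ℓ * (m - r + 1) := by
  have hs : m - r + 1 ≤ m := by omega
  let f : Matrix (Fin ℓ) (Fin m) k →ₗ[k] Matrix (Fin ℓ) (Fin (m - r + 1)) k :=
    { toFun := fun X => X.submatrix id (Fin.castLE hs)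
      map_add' := fun _ _ => rfl
      map_smul' := fun _ _ => rfl }
  have hf : Function.Injective (f.comp C.subtype) := by
    rw [← LinearMap.ker_eq_bot, LinearMap.ker_eq_bot']
    rintro ⟨X, hX⟩ h
    by_contra hne
    have hrank := hC X hX fun h0 => hne (Subtype.ext h0)
    have := X.rank_le_sub_of_castLE_col_eq_zero hs fun i j => congrFun (congrFun h i) j
    omega
  simpa [Module.finrank_matrix] using LinearMap.finrank_le_finrank_of_injective hf
end

section
/- Let k be a field and K/k a finite Galois extension whose Galois group is cyclic, generated by θ. Let p = Σ_{i=0}^{t} p_i x^i ∈ K[x] be a nonzero polynomial of degree t. Then the kernel of the k-linear endomorphism p(θ) : K → K, α ↦ Σ_{i=0}^{t} p_i θ^i(α), is a k-subspace of K of dimension at most t. -/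
open Finset in
/-- Summation by parts for a combination of powers of an automorphism. -/
theorem AlgEquiv.sum_mul_pow_apply_eq {k K : Type*} [Field k] [Field K] [Algebra k K]
    (θ : K ≃ₐ[k] K) (c : ℕ → K) (x : K) (n : ℕ) :
    ∑ i ∈ range (n + 1), c i * (θ ^ i) x =
      ∑ j ∈ range n, (-∑ i ∈ range (j + 1), c i) * (θ ^ j) (θ x - x) +
        (∑ i ∈ range (n + 1), c i) * (θ ^ n) x := by
  induction n with
  | zero => simp
  | succ n ih =>
    have h : (θ ^ n) (θ x) = (θ ^ (n + 1)) x := by rw [pow_succ, AlgEquiv.mul_apply]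
    rw [sum_range_succ, ih, sum_range_succ (fun j ↦ _ * (θ ^ j) (θ x - x)),
      sum_range_succ c (n + 1), map_sub, h]
    ring

/-- An element fixed by a generator of a Galois group lies in the base field. -/
theorem IsGalois.mem_range_algebraMap_of_generator_fixed {k K : Type*} [Field k] [Field K]
    [Algebra k K] [FiniteDimensional k K] [IsGalois k K]
    {θ : K ≃ₐ[k] K} (hθ : ∀ σ : K ≃ₐ[k] K, σ ∈ Subgroup.zpowers θ) {x : K} (hx : θ x = x) :
    x ∈ Set.range (algebraMap k K) := by
  rw [IsGalois.mem_range_algebraMap_iff_fixed]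
  intro σ
  have h : Subgroup.zpowers θ ≤ MulAction.stabilizer (K ≃ₐ[k] K) x := by
    rw [Subgroup.zpowers_le]
    exact hx
  exact h (hθ σ)

open Finset in
/-- A combination of `1, θ, …, θ ^ t` with nonzero leading coefficient, where `θ` generates the
Galois group, has kernel of dimension at most `t`. -/
theorem finrank_ker_sum_smul_pow_le {k K : Type*} [Field k] [Field K] [Algebra k K]
    [FiniteDimensional k K] [IsGalois k K]
    (θ : K ≃ₐ[k] K) (hθ : ∀ σ : K ≃ₐ[k] K, σ ∈ Subgroup.zpowers θ) (t : ℕ) (c : ℕ → K)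
    (hc : c t ≠ 0) :
    Module.finrank k (LinearMap.ker (∑ i ∈ range (t + 1),
      c i • ((θ ^ i : K ≃ₐ[k] K).toLinearMap : K →ₗ[k] K))) ≤ t := by
  induction t generalizing c with
  | zero =>
    rw [Nat.le_zero, Submodule.finrank_eq_zero, LinearMap.ker_eq_bot']
    intro x hx
    simpa [hc] using hx
  | succ t ih =>
    set W := LinearMap.ker (∑ i ∈ range (t + 1 + 1),
      c i • ((θ ^ i : K ≃ₐ[k] K).toLinearMap : K →ₗ[k] K)) with hW
    have mem_W (x : K) : x ∈ W ↔ ∑ i ∈ range (t + 1 + 1), c i * (θ ^ i) x = 0 := by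
      simp [hW, LinearMap.mem_ker, LinearMap.sum_apply]
    by_cases hbot : W = ⊥
    · rw [hbot, finrank_bot]
      exact Nat.zero_le _
    obtain ⟨u, huW, hu⟩ := Submodule.exists_mem_ne_zero_of_ne_bot hbot
    have hsum : ∑ i ∈ range (t + 1 + 1), c i * (θ ^ i) u = 0 := (mem_W u).1 huW
    set d : ℕ → K := fun j ↦ -∑ i ∈ range (j + 1), c i * (θ ^ i) u with hd
    have hdt : d t ≠ 0 := by
      have h : d t = c (t + 1) * (θ ^ (t + 1)) u := by
        rw [sum_range_succ] at hsum
        exact neg_eq_of_add_eq_zero_right hsum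
      rw [h]
      exact mul_ne_zero hc ((map_ne_zero_iff _ (AlgEquiv.injective _)).2 hu)
    let f : W →ₗ[k] K :=
      (θ.toLinearMap - LinearMap.id) ∘ₗ LinearMap.mulLeft k u⁻¹ ∘ₗ W.subtype
    have f_apply (x : W) : f x = θ (u⁻¹ * x) - u⁻¹ * x := rfl
    have hrange : Module.finrank k (LinearMap.range f) ≤ t := by
      refine (Submodule.finrank_mono ?_).trans (ih d hdt)
      rintro _ ⟨x, rfl⟩
      have h := AlgEquiv.sum_mul_pow_apply_eq θ (fun i ↦ c i * (θ ^ i) u) (u⁻¹ * x) (t + 1)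
      simp only [hsum, zero_mul, add_zero, mul_assoc, ← map_mul, mul_inv_cancel_left₀ hu,
        (mem_W x).1 x.2] at h
      simpa [LinearMap.mem_ker, LinearMap.sum_apply, f_apply, hd] using h.symm
    have hker : Module.finrank k (LinearMap.ker f) ≤ 1 := by
      refine finrank_le_one ⟨⟨u, huW⟩, by simp [f_apply, hu]⟩ ?_
      rintro ⟨x, hx⟩
      obtain ⟨a, ha⟩ := IsGalois.mem_range_algebraMap_of_generator_fixed hθ
        (sub_eq_zero.1 ((f_apply x).symm.trans hx))
      refine ⟨a, Subtype.ext (Subtype.ext ?_)⟩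
      change a • u = x
      rw [Algebra.smul_def, ha, mul_comm, mul_inv_cancel_left₀ hu]
    have := f.finrank_range_add_finrank_ker
    lia

/-- Let `K/k` be a finite Galois extension with cyclic Galois group generated by `θ`,
and let `p = Σ_{i=0}^t p_i x^i ∈ K[x]` be a nonzero polynomial of degree `t`.
Then the kernel of the `k`-linear endomorphism `p(θ) : α ↦ Σ_i p_i θ^i(α)` of `K`
has `k`-dimension at most `t`. -/
theorem ker_dim_le_of_poly_in_generator {k K : Type*} [Field k] [Field K] [Algebra k K]
    [FiniteDimensional k K] [IsGalois k K]
    (θ : K ≃ₐ[k] K) (hθ : ∀ σ : K ≃ₐ[k] K, σ ∈ Subgroup.zpowers θ)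
    (p : Polynomial K) (hp : p ≠ 0) :
    Module.finrank k
      (LinearMap.ker (∑ i ∈ Finset.range (p.natDegree + 1),
        p.coeff i • ((θ ^ i : K ≃ₐ[k] K).toLinearMap : K →ₗ[k] K)))
      ≤ p.natDegree := by
  exact finrank_ker_sum_smul_pow_le θ hθ p.natDegree p.coeff (by simpa using hp)
end

section
/- Let K/k be a finite Galois extension whose Galois group is cyclic, generated by θ, and let v = (v_1,…,v_m) ∈ K^m have rank r (i.e., the k-span of v_1,…,v_m in K has k-dimension r). Then the vectors v, θ(v), …, θ^{r−1}(v) ∈ K^m are linearly independent over K. -/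
theorem Finset.sum_range_mul_eq_sum_range_partialSum_mul_sub {R : Type*} [CommRing R]
    (c y : ℕ → R) (n : ℕ) :
    ∑ i ∈ Finset.range n, c i * y i =
      ∑ i ∈ Finset.range n, (∑ l ∈ Finset.range (i + 1), c l) * (y i - y (i + 1)) +
        (∑ l ∈ Finset.range n, c l) * y n := by
  induction n with
  | zero => simp
  | succ n ih =>
    rw [Finset.sum_range_succ, ih, Finset.sum_range_succ _ n, Finset.sum_range_succ c n]
    ring

/-- If the fixed field of `θ` is `k`, a `θ`-polynomial with `n` coefficients that vanishes at `n`
elements linearly independent over `k` is zero. -/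
theorem AlgEquiv.eq_zero_of_sum_mul_pow_apply_eq_zero {k K : Type*} [Field k] [Field K]
    [Algebra k K] (θ : K ≃ₐ[k] K) (hfix : ∀ x, θ x = x → x ∈ Set.range (algebraMap k K))
    {n : ℕ} {w : Fin n → K} (hw : LinearIndependent k w) {c : ℕ → K}
    (hc : ∀ j, ∑ i ∈ Finset.range n, c i * (θ ^ i) (w j) = 0) {i : ℕ} (hi : i < n) :
    c i = 0 := by
  induction n generalizing c i with
  | zero => omega
  | succ n ih =>
    have ha : w 0 ≠ 0 := hw.ne_zero 0
    set a := w 0 with ha_def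
    set c' : ℕ → K := fun i => c i * (θ ^ i) a with hc'
    set S : ℕ → K := fun i => ∑ l ∈ Finset.range i, c' l with hS
    have hvanish : ∀ j, ∑ i ∈ Finset.range (n + 1), c' i * (θ ^ i) (w j / a) = 0 := by
      intro j
      rw [← hc j]
      refine Finset.sum_congr rfl fun i _ => ?_
      rw [hc', mul_assoc, ← map_mul, mul_div_cancel₀ _ ha]
    have hlast : S (n + 1) = 0 := by
      simpa [← ha_def, div_self ha] using hvanish 0
    have hind : LinearIndependent k fun j : Fin n => w j.succ / a - θ (w j.succ / a) := by
      rw [Fintype.linearIndependent_iff]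
      intro g hg j
      obtain ⟨t, ht⟩ := hfix (∑ j, g j • (w j.succ / a)) (by
        rw [map_sum]
        simp only [smul_sub, Finset.sum_sub_distrib, sub_eq_zero] at hg
        simpa only [map_smul] using hg.symm)
      have hrel : ∑ j, (Fin.cons (-t) g : Fin (n + 1) → k) j • w j = 0 := by
        have hta : t • a = ∑ j, g j • w j.succ := by
          rw [Algebra.smul_def, ht, Finset.sum_mul]
          refine Finset.sum_congr rfl fun j _ => ?_
          rw [smul_mul_assoc, div_mul_cancel₀ _ ha]
        simp [Fin.sum_univ_succ, ← hta, ← ha_def]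
      simpa using Fintype.linearIndependent_iff.1 hw _ hrel j.succ
    have hS_zero : ∀ i, i ≤ n + 1 → S i = 0 := by
      intro i hi
      obtain rfl | hi := hi.eq_or_lt
      · exact hlast
      cases i with
      | zero => simp [hS]
      | succ i =>
        refine ih hind (c := fun i => S (i + 1)) (fun j => ?_) (by omega)
        have h := hvanish j.succ
        rw [Finset.sum_range_mul_eq_sum_range_partialSum_mul_sub,
          Finset.sum_range_succ] at h
        change _ + S (n + 1) * _ + S (n + 1) * _ = 0 at h
        rw [hlast, zero_mul, zero_mul, add_zero, add_zero] at h
        simpa only [map_sub, pow_succ, AlgEquiv.mul_apply] using h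
    have h : c' i = 0 := by
      have := Finset.sum_range_succ c' i
      change S (i + 1) = S i + c' i at this
      rwa [hS_zero _ (by omega), hS_zero _ (by omega), zero_add, eq_comm] at this
    exact (mul_eq_zero.1 h).resolve_right ((map_ne_zero (θ ^ i)).2 ha)

/-- Let `K/k` be a finite Galois extension with cyclic Galois group generated by `θ`,
and let `v ∈ K^m` have rank `r` (the `k`-dimension of the `k`-span of its entries).
Then `v, θ(v), …, θ^{r−1}(v)` are linearly independent over `K`. -/
theorem gabidulin_iterates_linearIndependent {k K : Type*} [Field k] [Field K] [Algebra k K]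
    [FiniteDimensional k K] [IsGalois k K]
    (θ : K ≃ₐ[k] K) (hθ : ∀ σ : K ≃ₐ[k] K, σ ∈ Subgroup.zpowers θ)
    {m r : ℕ} (v : Fin m → K)
    (hv : Module.finrank k (Submodule.span k (Set.range v)) = r) :
    LinearIndependent K (fun i : Fin r => (fun j => (θ ^ (i : ℕ)) (v j) : Fin m → K)) := by
  have hfix : ∀ x, θ x = x → x ∈ Set.range (algebraMap k K) := by
    intro x hx
    refine (IsGalois.mem_range_algebraMap_iff_fixed x).2 fun σ => ?_
    have hle : Subgroup.zpowers θ ≤ MulAction.stabilizer (K ≃ₐ[k] K) x := by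
      rw [Subgroup.zpowers_le]
      exact hx
    exact hle (hθ σ)
  rw [Fintype.linearIndependent_iff]
  intro g hg i
  let c : ℕ → K := fun i => if h : i < r then g ⟨i, h⟩ else 0
  let L : K →ₗ[k] K := ∑ i : Fin r, g i • ((θ ^ (i : ℕ) : K ≃ₐ[k] K) : K →ₐ[k] K).toLinearMap
  have hL : Submodule.span k (Set.range v) ≤ LinearMap.ker L := by
    rw [Submodule.span_le]
    rintro _ ⟨j, rfl⟩
    simpa [L] using congrFun hg j
  let b := Module.finBasisOfFinrankEq k (Submodule.span k (Set.range v)) hv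
  have hb : LinearIndependent k fun j => (b j : K) :=
    b.linearIndependent.map' (Submodule.subtype _) (Submodule.ker_subtype _)
  have hc : c i = 0 := by
    refine θ.eq_zero_of_sum_mul_pow_apply_eq_zero hfix hb (fun j => ?_) i.2
    rw [Finset.sum_range]
    simpa [L, c] using hL (b j).2
  simpa [c] using hc
end

section
/- Let K/k be a finite Galois extension of degree ℓ whose Galois group is cyclic, generated by θ, let v ∈ K^m be a Gabidulin vector and 1 ≤ d < m. Then dim_K C̃(v,θ,d) = d; equivalently, the k-dimension of C̃(v,θ,d) regarded as a k-vector space equals ℓ·d. -/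
/-- The Gabidulin-like code `C̃(v,θ,d) = span_K{v, θ(v), …, θ^{d−1}(v)} ≤ K^m`,
where `θ` acts entrywise on `K^m`. -/
def gabCode {k K : Type*} [Field k] [Field K] [Algebra k K] {m : ℕ}
    (θ : K ≃ₐ[k] K) (v : Fin m → K) (d : ℕ) : Submodule K (Fin m → K) :=
  Submodule.span K (Set.range fun i : Fin d => (fun j => (θ ^ (i : ℕ)) (v j) : Fin m → K))

/-- If `θ` generates the Galois group of `K/k`, a `θ`-polynomial `∑_{i<d} c_i θ^i` vanishing on a
`k`-subspace of `K` of dimension at least `d` has only zero coefficients. -/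
theorem coeff_eq_zero_of_vanishes_on_submodule {k K : Type*} [Field k] [Field K] [Algebra k K]
    [FiniteDimensional k K] [IsGalois k K]
    (θ : K ≃ₐ[k] K) (hθ : ∀ σ : K ≃ₐ[k] K, σ ∈ Subgroup.zpowers θ) (d : ℕ) :
    ∀ (V : Submodule k K) (c : ℕ → K), d ≤ Module.finrank k V →
      (∀ x ∈ V, ∑ i ∈ Finset.range d, c i * (θ ^ i) x = 0) → ∀ i < d, c i = 0 := by
  induction d with
  | zero => intro V c _ _ i hi; omega
  | succ d ih =>
    intro V c hV hc
    obtain ⟨w, hwV, hw⟩ : ∃ w ∈ V, w ≠ 0 := by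
      refine V.exists_mem_ne_zero_of_ne_bot fun h => ?_
      rw [h, finrank_bot] at hV
      omega
    let f : K →ₗ[k] K := (θ.toLinearMap - LinearMap.id) ∘ₗ LinearMap.mulLeft k w⁻¹
    have hf : ∀ x, f x = θ (w⁻¹ * x) - w⁻¹ * x := fun x => rfl
    have hker : Module.finrank k (LinearMap.ker (f.domRestrict V)) ≤ 1 := by
      refine (Submodule.finrank_mono (t := Submodule.span k {(⟨w, hwV⟩ : V)}) ?_).trans
        (finrank_span_singleton (K := k) (v := (⟨w, hwV⟩ : V)) (by simpa using hw)).le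
      rintro ⟨x, hx⟩ hfx
      have hfix : θ (w⁻¹ * x) = w⁻¹ * x := by
        simpa [hf, sub_eq_zero] using hfx
      have hle : Subgroup.zpowers θ ≤ MulAction.stabilizer (K ≃ₐ[k] K) (w⁻¹ * x) := by
        rw [Subgroup.zpowers_le]
        exact hfix
      obtain ⟨a, ha⟩ := (IsGalois.mem_range_algebraMap_iff_fixed (F := k) (w⁻¹ * x)).2
        fun σ => hle (hθ σ)
      refine Submodule.mem_span_singleton.2 ⟨a, Subtype.ext ?_⟩
      simp only [Submodule.coe_smul, Algebra.smul_def, ha]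
      field_simp
    have hW : d ≤ Module.finrank k (V.map f) := by
      have h := LinearMap.finrank_range_add_finrank_ker (f.domRestrict V)
      rw [LinearMap.range_domRestrict] at h
      omega
    let S : ℕ → K := fun n => ∑ i ∈ Finset.range n, c i * (θ ^ i) w
    have hS : S (d + 1) = 0 := hc w hwV
    have habel : ∀ (a : ℕ → K) (n : ℕ), ∑ i ∈ Finset.range (n + 1), c i * (θ ^ i) w * a i =
        S (n + 1) * a n - ∑ i ∈ Finset.range n, S (i + 1) * (a (i + 1) - a i) := by
      intro a n
      induction n with
      | zero => simp [S]
      | succ n ihn =>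
        rw [Finset.sum_range_succ, ihn, Finset.sum_range_succ _ n]
        simp only [S, Finset.sum_range_succ _ (n + 1)]
        ring
    have hSzero : ∀ i < d, S (i + 1) = 0 := by
      refine ih (V.map f) (fun i => S (i + 1)) hW ?_
      rintro _ ⟨x, hx, rfl⟩
      have h := habel (fun i => (θ ^ i) (w⁻¹ * x)) d
      have h0 : ∑ i ∈ Finset.range (d + 1), c i * (θ ^ i) w * (θ ^ i) (w⁻¹ * x) = 0 := by
        rw [← hc x hx]
        refine Finset.sum_congr rfl fun i _ => ?_
        rw [mul_assoc, ← map_mul, mul_inv_cancel_left₀ hw]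
      rw [h0, hS, zero_mul, zero_sub, eq_comm, neg_eq_zero] at h
      rw [← h]
      refine Finset.sum_congr rfl fun i _ => ?_
      rw [hf, map_sub, pow_succ, AlgEquiv.mul_apply]
    have hSall : ∀ i ≤ d + 1, S i = 0 := by
      intro i hi
      rcases i with _ | i
      · simp [S]
      · rcases Nat.lt_or_ge i d with h | h
        · exact hSzero i h
        · obtain rfl : i = d := by omega
          exact hS
    intro i hi
    have h1 : S (i + 1) = S i + c i * (θ ^ i) w := Finset.sum_range_succ _ i
    rw [hSall _ hi, hSall _ hi.le, zero_add, eq_comm, mul_eq_zero] at h1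
    exact h1.resolve_right ((map_ne_zero (θ ^ i)).2 hw)

/-- The first `d ≤ m` iterates of a Gabidulin vector of length `m` under a generator `θ` of the
Galois group are linearly independent over `K`. -/
theorem linearIndependent_iterates {k K : Type*} [Field k] [Field K] [Algebra k K]
    [FiniteDimensional k K] [IsGalois k K]
    (θ : K ≃ₐ[k] K) (hθ : ∀ σ : K ≃ₐ[k] K, σ ∈ Subgroup.zpowers θ)
    {m : ℕ} (v : Fin m → K)
    (hv : Module.finrank k (Submodule.span k (Set.range v)) = m) (d : ℕ) (hdm : d ≤ m) :
    LinearIndependent K fun i : Fin d => (fun j => (θ ^ (i : ℕ)) (v j) : Fin m → K) := by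
  rw [Fintype.linearIndependent_iff]
  intro g hg i
  let c : ℕ → K := fun n => if h : n < d then g ⟨n, h⟩ else 0
  have hc : ∀ i : Fin d, c i = g i := fun i => by simp [c]
  rw [← hc]
  refine coeff_eq_zero_of_vanishes_on_submodule θ hθ d (Submodule.span k (Set.range v)) c
    (hdm.trans hv.ge) ?_ i i.2
  intro x hx
  let L : K →ₗ[k] K := ∑ i ∈ Finset.range d, LinearMap.mulLeft k (c i) ∘ₗ (θ ^ i).toLinearMap
  have hL : ∀ x, L x = ∑ i ∈ Finset.range d, c i * (θ ^ i) x := fun x => by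
    simp [L, LinearMap.sum_apply]
  rw [← hL, ← LinearMap.mem_ker]
  refine Submodule.span_le.2 ?_ hx
  rintro _ ⟨j, rfl⟩
  have h := congrFun hg j
  rw [SetLike.mem_coe, LinearMap.mem_ker, hL, Finset.sum_range]
  simpa [hc, Finset.sum_apply] using h

/-- Let `K/k` be a finite Galois extension of degree `ℓ` with cyclic Galois group
generated by `θ`, let `v ∈ K^m` be a Gabidulin vector and `1 ≤ d < m`.  Then
`dim_K C̃(v,θ,d) = d`, equivalently `dim_k C̃(v,θ,d) = ℓ·d`. -/
theorem gabCode_finrank {k K : Type*} [Field k] [Field K] [Algebra k K]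
    [FiniteDimensional k K] [IsGalois k K]
    (θ : K ≃ₐ[k] K) (hθ : ∀ σ : K ≃ₐ[k] K, σ ∈ Subgroup.zpowers θ)
    {m : ℕ} (v : Fin m → K)
    (hv : Module.finrank k (Submodule.span k (Set.range v)) = m)
    (d : ℕ) (hd1 : 1 ≤ d) (hdm : d < m) :
    Module.finrank K (gabCode θ v d) = d ∧
    Module.finrank k (Submodule.restrictScalars k (gabCode θ v d)) =
      Module.finrank k K * d := by
  have h : Module.finrank K (gabCode θ v d) = d := by
    rw [gabCode, finrank_span_eq_card (linearIndependent_iterates θ hθ v hv d hdm.le),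
      Fintype.card_fin]
  refine ⟨h, ?_⟩
  have h2 := Module.finrank_mul_finrank k K (gabCode θ v d)
  rw [h] at h2
  exact h2.symm
end

section
/- Let K/k be a field extension of finite degree ℓ and let A be a k-subalgebra of End_k(K) containing all multiplication operators μ_a : x ↦ a·x for a ∈ K. Then there exists an intermediate field k ≤ F ≤ K such that A equals the centralizer in End_k(K) of the set {μ_a : a ∈ F}; equivalently, A = End_F(K), which is isomorphic as a k-algebra to the algebra of s×s matrices over F, where s = [K:F]. -/
/-- A subalgebra of `End_k(K)` containing all multiplication operators acts irreducibly on `K`. -/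
theorem isSimpleModule_of_lmul_mem {k K : Type*} [Field k] [Field K] [Algebra k K]
    (A : Subalgebra k (Module.End k K))
    (hA : ∀ a : K, (Algebra.lmul k K a : Module.End k K) ∈ A) : IsSimpleModule A K := by
  rw [isSimpleModule_iff_toSpanSingleton_surjective]
  refine ⟨inferInstance, fun m hm x => ⟨⟨_, hA (x / m)⟩, ?_⟩⟩
  change x / m * m = x
  exact div_mul_cancel₀ x hm

/-- The elements of `K` whose multiplication operators commute with every operator in `A`. -/
def mulCommutant {k K : Type*} [Field k] [Field K] [Algebra k K]
    (A : Subalgebra k (Module.End k K)) : IntermediateField k K where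
  toSubalgebra := (Subalgebra.centralizer k (A : Set (Module.End k K))).comap (Algebra.lmul k K)
  inv_mem' x hx := by
    rcases eq_or_ne x 0 with rfl | h0
    · simp
    change ∀ T ∈ A, T * Algebra.lmul k K x = Algebra.lmul k K x * T at hx
    change ∀ T ∈ A, T * Algebra.lmul k K x⁻¹ = Algebra.lmul k K x⁻¹ * T
    intro T hT
    ext y
    have h : T (x * (x⁻¹ * y)) = x * T (x⁻¹ * y) := LinearMap.congr_fun (hx T hT) (x⁻¹ * y)
    change T (x⁻¹ * y) = x⁻¹ * T y
    rw [mul_inv_cancel_left₀ h0] at h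
    rw [h, inv_mul_cancel_left₀ h0]

theorem mem_mulCommutant {k K : Type*} [Field k] [Field K] [Algebra k K]
    {A : Subalgebra k (Module.End k K)} {a : K} :
    a ∈ mulCommutant A ↔ ∀ T ∈ A, ∀ x, T (a * x) = a * T x :=
  ⟨fun h T hT x => LinearMap.congr_fun (h T hT) x, fun h T hT => LinearMap.ext (h T hT)⟩

theorem mem_centralizer_lmul_iff {k K : Type*} [Field k] [Field K] [Algebra k K]
    {S : Set K} {T : Module.End k K} :
    T ∈ Subalgebra.centralizer k ((fun a : K => (Algebra.lmul k K a : Module.End k K)) '' S) ↔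
      ∀ a ∈ S, ∀ x, T (a * x) = a * T x := by
  rw [Subalgebra.mem_centralizer_iff, Set.forall_mem_image]
  exact forall₂_congr fun a _ => ⟨fun h x => (LinearMap.congr_fun h x).symm,
    fun h => LinearMap.ext fun x => (h x).symm⟩

theorem eq_centralizer_mulCommutant {k K : Type*} [Field k] [Field K]
    [Algebra k K] [FiniteDimensional k K] (A : Subalgebra k (Module.End k K))
    (hA : ∀ a : K, (Algebra.lmul k K a : Module.End k K) ∈ A) :
    A = Subalgebra.centralizer k ((fun a : K => (Algebra.lmul k K a : Module.End k K)) ''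
      (mulCommutant A : Set K)) := by
  have := isSimpleModule_of_lmul_mem A hA
  refine le_antisymm (fun T hT => mem_centralizer_lmul_iff.2 fun a ha =>
    mem_mulCommutant.1 ha T hT) fun T hT => ?_
  rw [mem_centralizer_lmul_iff] at hT
  have apply_eq (g : Module.End A K) (x : K) : g x = g 1 * x := by
    have h : g (x * 1) = x * g 1 := g.map_smul ⟨_, hA x⟩ 1
    rwa [mul_one, mul_comm] at h
  let f : Module.End (Module.End A K) K :=
    { toFun := T
      map_add' := T.map_add
      map_smul' := fun g x => by
        have hg : g 1 ∈ mulCommutant A := mem_mulCommutant.2 fun S hS x => by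
          rw [← apply_eq g x, ← apply_eq g (S x)]
          exact (g.map_smul ⟨S, hS⟩ x).symm
        change T (g x) = g (T x)
        rw [apply_eq g x, apply_eq g (T x), hT _ hg] }
  let b := Module.finBasis k K
  classical
  obtain ⟨r, hr⟩ := jacobson_density (R := A) (M := K) f (Finset.univ.image b)
  have : T = r := b.ext fun i => hr (b i) (by simp)
  exact this ▸ r.2

/-- The centralizer of the multiplication operators by elements of `F` is `End_F(K)`. -/
def centralizerLmulEquivEnd {k K : Type*} [Field k] [Field K] [Algebra k K]
    (F : IntermediateField k K) :
    Subalgebra.centralizer k ((fun a : K => (Algebra.lmul k K a : Module.End k K)) ''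
      (F : Set K)) ≃ₐ[k] Module.End F K where
  toFun T :=
    { toFun := T.1
      map_add' := T.1.map_add
      map_smul' := fun a x => mem_centralizer_lmul_iff.1 T.2 a a.2 x }
  invFun T := ⟨T.restrictScalars k,
    mem_centralizer_lmul_iff.2 fun a ha x => T.map_smul ⟨a, ha⟩ x⟩
  left_inv _ := rfl
  right_inv _ := rfl
  map_mul' _ _ := rfl
  map_add' _ _ := rfl
  commutes' _ := rfl

/-- **Double centraliser lemma for algebras between `Δ(K)` and `End_k(K)`.**
Let `K/k` be a finite field extension and `A` a `k`-subalgebra of `End_k(K)`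
containing all multiplication operators `μ_a : x ↦ a·x` (`a ∈ K`).  Then there is
an intermediate field `k ≤ F ≤ K` such that `A` is the centraliser in `End_k(K)` of
`{μ_a : a ∈ F}`, i.e. `A = End_F(K) ≅ F^{s×s}` with `s = [K:F]`. -/
theorem subalgebra_containing_mul_ops_eq_centralizer {k K : Type*} [Field k] [Field K]
    [Algebra k K] [FiniteDimensional k K]
    (A : Subalgebra k (Module.End k K))
    (hA : ∀ a : K, (Algebra.lmul k K a : Module.End k K) ∈ A) :
    ∃ F : IntermediateField k K,
      A = Subalgebra.centralizer k
            ((fun a : K => (Algebra.lmul k K a : Module.End k K)) '' (F : Set K)) ∧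
      Nonempty (A ≃ₐ[k]
        Matrix (Fin (Module.finrank F K)) (Fin (Module.finrank F K)) F) :=
  ⟨mulCommutant A, eq_centralizer_mulCommutant A hA,
    ⟨((Subalgebra.equivOfEq _ _ (eq_centralizer_mulCommutant A hA)).trans
      (centralizerLmulEquivEnd _)).trans
        ((LinearMap.toMatrixAlgEquiv (Module.finBasis (mulCommutant A) K)).restrictScalars k)⟩⟩
end

section
/- Let K/k be a finite Galois extension whose Galois group is cyclic, generated by θ, let k ≤ F ≤ K be an intermediate field (so that F/k is cyclic Galois with Galois group generated by the restriction θ_F of θ to F), let D̃ be an F-subspace of F^m, and let C̃ ⊆ K^m be the K-span of the image of D̃ in K^m. If C̃ = C̃(v,θ,d) for some Gabidulin vector v ∈ K^m and some 1 ≤ d < m, then D̃ = C̃(w,θ_F,d) for some Gabidulin vector w ∈ F^m. -/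
set_option synthInstance.maxHeartbeats 1000000
set_option maxHeartbeats 1000000

/-- The `K`-span in `K^m` of (the image of) an `F`-subspace `D̃ ≤ F^m`, for an
intermediate field `k ≤ F ≤ K`; this is `D̃ ⊗_F K`. -/
def liftSpan {k K : Type*} [Field k] [Field K] [Algebra k K] {m : ℕ}
    (F : IntermediateField k K) (D : Submodule F (Fin m → F)) :
    Submodule K (Fin m → K) :=
  Submodule.span K ((fun w : Fin m → F => (fun j => (w j : K) : Fin m → K)) ''
    (D : Set (Fin m → F)))

/-- Nonsingularity of Moore matrices, for an automorphism `θ` of `K` whose fixed field is `k`. -/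
theorem moore_coeff_eq_zero {k K : Type*} [Field k] [Field K] [Algebra k K]
    (θ : K ≃ₐ[k] K) (hfix : ∀ x : K, θ x = x → ∃ a : k, algebraMap k K a = x) (n : ℕ) :
    ∀ v : Fin n → K, LinearIndependent k v → ∀ c : ℕ → K,
      (∀ j, ∑ i ∈ Finset.range n, c i * (θ ^ i) (v j) = 0) → ∀ i < n, c i = 0 := by
  induction n with
  | zero => intro _ _ _ _ i hi; omega
  | succ n ih =>
    intro v hv c hc
    have hv0 : v 0 ≠ 0 := hv.ne_zero 0
    set b : ℕ → K := fun i => c i * (θ ^ i) (v 0) with hb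
    set e : ℕ → K := fun i => ∑ l ∈ Finset.range (i + 1), b l with he
    have abel : ∀ (f : ℕ → K) (N : ℕ), ∑ i ∈ Finset.range (N + 1), b i * f i =
        e N * f N - ∑ i ∈ Finset.range N, e i * (f (i + 1) - f i) := by
      intro f N
      induction N with
      | zero => simp [he]
      | succ N ihN =>
        rw [Finset.sum_range_succ, ihN, Finset.sum_range_succ _ N]
        have : e (N + 1) = e N + b (N + 1) := by simp only [he]; rw [Finset.sum_range_succ]
        rw [this]; ring
    have hen : e n = 0 := hc 0
    have hen' : ∀ i < n, e i = 0 := by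
      refine ih (fun j => θ (v j.succ / v 0) - v j.succ / v 0) ?_ e fun j => ?_
      · rw [Fintype.linearIndependent_iff]
        intro g hg
        have hx : θ (∑ j, g j • (v j.succ / v 0)) = ∑ j, g j • (v j.succ / v 0) := by
          rw [← sub_eq_zero, ← hg, map_sum, ← Finset.sum_sub_distrib]
          exact Finset.sum_congr rfl fun j _ => by rw [map_smul, smul_sub]
        obtain ⟨a, ha⟩ := hfix _ hx
        have hrel : ∑ j, (Fin.cons (-a) g : Fin (n + 1) → k) j • v j = 0 := by
          rw [Fin.sum_univ_succ]
          simp only [Fin.cons_zero, Fin.cons_succ]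
          have h2 : ∑ j, g j • v j.succ = a • v 0 := by
            rw [Algebra.smul_def, ha, Finset.sum_mul]
            exact Finset.sum_congr rfl fun j _ => by
              rw [smul_mul_assoc, div_mul_cancel₀ _ hv0]
          rw [h2, neg_smul, neg_add_cancel]
        intro j
        simpa using Fintype.linearIndependent_iff.1 hv _ hrel j.succ
      · have h1 := abel (fun i => (θ ^ i) (v j.succ / v 0)) n
        rw [hen, zero_mul, zero_sub] at h1
        have h2 : ∑ i ∈ Finset.range (n + 1), b i * (θ ^ i) (v j.succ / v 0) = 0 := by
          rw [← hc j.succ]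
          refine Finset.sum_congr rfl fun i _ => ?_
          rw [hb, mul_assoc, ← map_mul, mul_div_cancel₀ _ hv0]
        rw [h2, eq_comm, neg_eq_zero] at h1
        rw [← h1]
        refine Finset.sum_congr rfl fun i _ => ?_
        rw [map_sub, pow_succ, AlgEquiv.mul_apply]
    have hb0 : ∀ i < n + 1, b i = 0 := by
      have heall : ∀ i < n + 1, e i = 0 := fun i hi => by
        rcases Nat.lt_succ_iff_lt_or_eq.1 hi with h | rfl
        exacts [hen' i h, hen]
      intro i hi
      cases i with
      | zero => simpa [he] using heall 0 hi
      | succ i =>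
        have h1 := heall (i + 1) hi
        have h2 := heall i (by omega)
        simp only [he] at h1 h2
        rwa [Finset.sum_range_succ, h2, zero_add] at h1
    intro i hi
    exact (mul_eq_zero.1 (hb0 i hi)).resolve_right ((map_ne_zero (θ ^ i)).2 hv0)

theorem pow_mem_gabCode {k K : Type*} [Field k] [Field K] [Algebra k K] {m d i : ℕ}
    (θ : K ≃ₐ[k] K) (v : Fin m → K) (hi : i < d) :
    (fun j => (θ ^ i) (v j)) ∈ gabCode θ v d :=
  Submodule.subset_span ⟨⟨i, hi⟩, rfl⟩

theorem mem_gabCode_iff {k K : Type*} [Field k] [Field K] [Algebra k K] {m d : ℕ}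
    {θ : K ≃ₐ[k] K} {v x : Fin m → K} :
    x ∈ gabCode θ v d ↔
      ∃ c : ℕ → K, x = ∑ i ∈ Finset.range d, c i • (fun j => (θ ^ i) (v j)) := by
  constructor
  · intro hx
    obtain ⟨c, rfl⟩ := (Submodule.mem_span_range_iff_exists_fun K).1 hx
    refine ⟨fun i => if h : i < d then c ⟨i, h⟩ else 0, ?_⟩
    rw [Finset.sum_range]
    exact Finset.sum_congr rfl fun i _ => by simp
  · rintro ⟨c, rfl⟩
    exact Submodule.sum_mem _ fun i hi =>
      Submodule.smul_mem _ _ (pow_mem_gabCode θ v (Finset.mem_range.1 hi))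

theorem pow_notMem_gabCode {k K : Type*} [Field k] [Field K] [Algebra k K]
    (θ : K ≃ₐ[k] K) (hfix : ∀ x : K, θ x = x → ∃ a : k, algebraMap k K a = x)
    {m d : ℕ} (hdm : d < m) {v : Fin m → K} (hv : LinearIndependent k v) :
    (fun j => (θ ^ d) (v j)) ∉ gabCode θ v d := by
  intro h
  obtain ⟨c, hc⟩ := mem_gabCode_iff.1 h
  have hinj : Function.Injective (Fin.castLE (Nat.succ_le_of_lt hdm)) := Fin.castLE_injective _
  have := moore_coeff_eq_zero θ hfix (d + 1) _ (hv.comp _ hinj)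
    (fun i => if i = d then -1 else c i) (fun j => by
      have hj := congrFun hc (Fin.castLE (Nat.succ_le_of_lt hdm) j)
      simp only [Finset.sum_apply, Pi.smul_apply, smul_eq_mul] at hj
      rw [Finset.sum_range_succ, if_pos rfl]
      simp only [Function.comp_apply]
      rw [hj, neg_one_mul, ← sub_eq_add_neg, sub_eq_zero]
      exact Finset.sum_congr rfl fun i hi => by
        rw [if_neg (Finset.mem_range.1 hi).ne]) d (Nat.lt_succ_self d)
  simp at this

/-- A Gabidulin vector is determined up to a scalar by its code: if an automorphism `τ`
commuting with `θ` preserves the code, then it preserves the line through `v`. -/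
theorem exists_smul_of_map_mem_gabCode {k K : Type*} [Field k] [Field K] [Algebra k K]
    (θ τ : K ≃ₐ[k] K) (hfix : ∀ x : K, θ x = x → ∃ a : k, algebraMap k K a = x)
    (hcomm : Commute θ τ) {m d : ℕ} (hd1 : 1 ≤ d) (hdm : d < m) {v : Fin m → K}
    (hv : LinearIndependent k v)
    (hstab : ∀ x ∈ gabCode θ v d, (fun j => τ (x j)) ∈ gabCode θ v d) :
    ∃ a : K, ∀ j, τ (v j) = a * v j := by
  obtain ⟨c, hc⟩ := mem_gabCode_iff.1 (hstab _ (pow_mem_gabCode θ v (i := 0) hd1))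
  have hτ : ∀ j, τ (v j) = ∑ i ∈ Finset.range d, c i * (θ ^ i) (v j) := fun j => by
    simpa using congrFun hc j
  have hzero : ∀ i < d, 0 < i → c i = 0 := by
    classical
    by_contra! hne
    obtain ⟨i₀, hi₀, hi₀', hci₀⟩ := hne
    obtain ⟨l, hl, hmax⟩ := Finset.exists_max_image
      ((Finset.range d).filter fun i => 0 < i ∧ c i ≠ 0) id
      ⟨i₀, by simp [hi₀, hi₀', hci₀]⟩
    simp only [Finset.mem_filter, Finset.mem_range, id] at hl hmax
    obtain ⟨hld, hl0, hcl⟩ := hl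
    have hvan : ∀ i < d, l < i → c i = 0 := fun i hi hli => by
      by_contra h
      have := hmax i ⟨hi, by omega, h⟩
      omega
    have hmem := hstab _ (pow_mem_gabCode θ v (i := d - l) (by omega))
    have hexp : (fun j => τ ((θ ^ (d - l)) (v j))) =
        ∑ i ∈ Finset.range (l + 1),
          (θ ^ (d - l)) (c i) • (fun j => (θ ^ (d - l + i)) (v j)) := by
      funext j
      have h1 : τ ((θ ^ (d - l)) (v j)) = (θ ^ (d - l)) (τ (v j)) := by
        rw [← AlgEquiv.mul_apply, ← AlgEquiv.mul_apply, (hcomm.pow_left (d - l)).eq]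
      rw [h1, hτ, map_sum, Finset.sum_apply]
      symm
      refine Finset.sum_subset_zero_on_sdiff (Finset.range_subset_range.2 hld) ?_ ?_
      · intro i hi
        simp only [Finset.mem_sdiff, Finset.mem_range] at hi
        rw [hvan i hi.1 (by omega)]
        simp
      · intro i _
        rw [Pi.smul_apply, smul_eq_mul, map_mul, pow_add, AlgEquiv.mul_apply]
    rw [hexp, Finset.sum_range_succ] at hmem
    have hlow := Submodule.sum_mem (gabCode θ v d) (t := Finset.range l)
      (f := fun i => (θ ^ (d - l)) (c i) • (fun j => (θ ^ (d - l + i)) (v j)))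
      fun i hi => Submodule.smul_mem _ _ (pow_mem_gabCode θ v (by
        have := Finset.mem_range.1 hi
        omega))
    have htop := (Submodule.add_mem_iff_right _ hlow).1 hmem
    rw [Submodule.smul_mem_iff _ ((map_ne_zero _).2 hcl), Nat.sub_add_cancel hld.le] at htop
    exact pow_notMem_gabCode θ hfix hdm hv htop
  refine ⟨c 0, fun j => ?_⟩
  rw [hτ, Finset.sum_eq_single_of_mem 0 (Finset.mem_range.2 hd1)]
  · simp
  · intro i hi hi0
    rw [hzero i (Finset.mem_range.1 hi) (Nat.pos_of_ne_zero hi0), zero_mul]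

theorem gabCode_smul {k K : Type*} [Field k] [Field K] [Algebra k K] {m : ℕ}
    (θ : K ≃ₐ[k] K) (v : Fin m → K) (d : ℕ) {a : K} (ha : a ≠ 0) :
    gabCode θ (a • v) d = gabCode θ v d := by
  have hvec : ∀ i : ℕ, (fun j => (θ ^ i) ((a • v) j)) =
      (θ ^ i) a • (fun j => (θ ^ i) (v j)) := fun i => by
    funext j; simp
  refine le_antisymm (Submodule.span_le.2 ?_) (Submodule.span_le.2 ?_)
  · rintro _ ⟨i, rfl⟩
    dsimp only
    rw [hvec]
    exact Submodule.smul_mem _ _ (pow_mem_gabCode θ v i.2)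
  · rintro _ ⟨i, rfl⟩
    have h := pow_mem_gabCode θ (a • v) i.2
    rwa [hvec, Submodule.smul_mem_iff _ ((map_ne_zero _).2 ha)] at h

theorem coe_mem_liftSpan_iff {k K : Type*} [Field k] [Field K] [Algebra k K] {m : ℕ}
    {F : IntermediateField k K} {D : Submodule F (Fin m → F)} {w : Fin m → F} :
    (fun j => (w j : K)) ∈ liftSpan F D ↔ w ∈ D := by
  refine ⟨fun hw => ?_, fun hw => Submodule.subset_span ⟨w, hw, rfl⟩⟩
  obtain ⟨π, hπ⟩ := (Algebra.linearMap F K).exists_leftInverse_of_injective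
    (LinearMap.ker_eq_bot.2 (algebraMap F K).injective)
  have hπ1 : ∀ x : F, π (x : K) = x := fun x => LinearMap.congr_fun hπ x
  have key : ∀ x ∈ liftSpan F D, ∀ a : K, (fun j => π (a * x j)) ∈ D := by
    intro x hx
    induction hx using Submodule.span_induction with
    | mem x hx =>
      obtain ⟨y, hy, rfl⟩ := hx
      intro a
      have : (fun j => π (a * (y j : K))) = π a • y := by
        funext j
        rw [Pi.smul_apply, smul_eq_mul, mul_comm, mul_comm (π a), ← smul_eq_mul (y j), ← map_smul]
        rfl
      rw [this]
      exact D.smul_mem _ hy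
    | zero =>
      intro a
      convert D.zero_mem using 1
      funext j; simp
    | add x y _ _ hx hy =>
      intro a
      convert D.add_mem (hx a) (hy a) using 1
      funext j; simp [mul_add]
    | smul b x _ hx =>
      intro a
      convert hx (a * b) using 1
      funext j; simp [mul_assoc]
  have h1 := key _ hw 1
  simp only [one_mul, hπ1] at h1
  exact h1

theorem map_mem_liftSpan {k K : Type*} [Field k] [Field K] [Algebra k K] {m : ℕ}
    {F : IntermediateField k K} {D : Submodule F (Fin m → F)} {τ : K ≃ₐ[k] K}
    (hτ : τ ∈ F.fixingSubgroup) {x : Fin m → K} (hx : x ∈ liftSpan F D) :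
    (fun j => τ (x j)) ∈ liftSpan F D := by
  induction hx using Submodule.span_induction with
  | mem x hx =>
    obtain ⟨y, hy, rfl⟩ := hx
    have : (fun j => τ (y j : K)) = fun j => (y j : K) := funext fun j =>
      (IntermediateField.mem_fixingSubgroup_iff F τ).1 hτ _ (y j).2
    rw [this]
    exact Submodule.subset_span ⟨y, hy, rfl⟩
  | zero =>
    convert (liftSpan F D).zero_mem using 1
    funext j; simp
  | add x y _ _ hx hy =>
    convert (liftSpan F D).add_mem hx hy using 1
    funext j; simp
  | smul b x _ hx =>
    convert (liftSpan F D).smul_mem (τ b) hx using 1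
    funext j; simp

theorem liftSpan_injective {k K : Type*} [Field k] [Field K] [Algebra k K] {m : ℕ}
    (F : IntermediateField k K) :
    Function.Injective (liftSpan F : Submodule F (Fin m → F) → Submodule K (Fin m → K)) :=
  fun D E h => Submodule.ext fun w => by
    rw [← coe_mem_liftSpan_iff, h, coe_mem_liftSpan_iff]

theorem liftSpan_gabCode {k K : Type*} [Field k] [Field K] [Algebra k K] {m : ℕ}
    (θ : K ≃ₐ[k] K) (F : IntermediateField k K) (θF : F ≃ₐ[k] F)
    (hθF : ∀ x : F, (θF x : K) = θ (x : K)) (w : Fin m → F) (d : ℕ) :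
    liftSpan F (gabCode θF w d) = gabCode θ (fun j => (w j : K)) d := by
  have hpow : ∀ (i : ℕ) (x : F), ((θF ^ i) x : K) = (θ ^ i) (x : K) := by
    intro i
    induction i with
    | zero => intro x; rfl
    | succ i ih =>
      intro x
      rw [pow_succ, pow_succ, AlgEquiv.mul_apply, AlgEquiv.mul_apply, ih, hθF]
  refine le_antisymm (Submodule.span_le.2 ?_) (Submodule.span_le.2 ?_)
  · rintro _ ⟨y, hy, rfl⟩
    obtain ⟨c, rfl⟩ := mem_gabCode_iff.1 hy
    refine mem_gabCode_iff.2 ⟨fun i => (c i : K), ?_⟩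
    funext j
    simp [← hpow, -AlgEquiv.coe_pow]
  · rintro _ ⟨i, rfl⟩
    exact Submodule.subset_span ⟨_, pow_mem_gabCode θF w i.2, funext fun j => hpow i (w j)⟩

/-- **Descent of Gabidulin-like codes to the splitting field.**
Let `K/k` be finite cyclic Galois generated by `θ`, let `k ≤ F ≤ K` be an intermediate
field, `θ_F` the restriction of `θ` to `F`, and `D̃ ≤ F^m` an `F`-subspace whose
`K`-span `C̃ ≤ K^m` is a Gabidulin-like code `C̃(v,θ,d)`.  Then `D̃` is itself a
Gabidulin-like code `C̃(w,θ_F,d)` for some Gabidulin vector `w ∈ F^m`. -/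
theorem descended_code_is_gabidulin {k K : Type*} [Field k] [Field K] [Algebra k K]
    [FiniteDimensional k K] [IsGalois k K]
    (θ : K ≃ₐ[k] K) (hθ : ∀ σ : K ≃ₐ[k] K, σ ∈ Subgroup.zpowers θ)
    (F : IntermediateField k K) (θF : F ≃ₐ[k] F)
    (hθF : ∀ x : F, (θF x : K) = θ (x : K))
    {m : ℕ} (d : ℕ) (hd1 : 1 ≤ d) (hdm : d < m)
    (D : Submodule F (Fin m → F)) (v : Fin m → K)
    (hv : Module.finrank k (Submodule.span k (Set.range v)) = m)
    (hC : liftSpan F D = gabCode θ v d) :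
    ∃ w : Fin m → F,
      Module.finrank k (Submodule.span k (Set.range w)) = m ∧ D = gabCode θF w d := by
  have hfix : ∀ x : K, θ x = x → ∃ a : k, algebraMap k K a = x := fun x hx => by
    refine (IsGalois.mem_range_algebraMap_iff_fixed x).2 fun σ => ?_
    have hle : Subgroup.zpowers θ ≤ MulAction.stabilizer (K ≃ₐ[k] K) x :=
      Subgroup.zpowers_le.2 hx
    exact hle (hθ σ)
  have hli : LinearIndependent k v :=
    linearIndependent_iff_card_eq_finrank_span.2 (by rw [Fintype.card_fin]; exact hv.symm)
  let z : Fin m := ⟨0, by omega⟩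
  have hz : v z ≠ 0 := hli.ne_zero z
  have hmem : ∀ j, (v z)⁻¹ * v j ∈ F := fun j => by
    rw [← IsGalois.fixedField_fixingSubgroup F, IntermediateField.mem_fixedField_iff]
    intro τ hτ
    have hcomm : Commute θ τ := by
      obtain ⟨n, rfl⟩ := hθ τ
      exact Commute.self_zpow θ n
    obtain ⟨a, ha⟩ := exists_smul_of_map_mem_gabCode θ τ hfix hcomm hd1 hdm hli
      fun x hx => by
        rw [← hC] at hx ⊢
        exact map_mem_liftSpan hτ hx
    have ha0 : a ≠ 0 := by
      rintro rfl
      exact hz ((map_eq_zero τ).1 (by rw [ha, zero_mul]))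
    rw [map_mul, map_inv₀, ha, ha]
    field_simp
  let w : Fin m → F := fun j => ⟨(v z)⁻¹ * v j, hmem j⟩
  refine ⟨w, ?_, liftSpan_injective F ?_⟩
  · have hw : LinearIndependent k w := by
      refine LinearIndependent.of_comp F.val.toLinearMap ?_
      exact hli.map' (LinearMap.mulLeft k (v z)⁻¹)
        (LinearMap.ker_eq_bot.2 (mul_right_injective₀ (inv_ne_zero hz)))
    rw [finrank_span_eq_card hw, Fintype.card_fin]
  · rw [liftSpan_gabCode θ F θF hθF, hC]
    exact (gabCode_smul θ v d (inv_ne_zero hz)).symm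
end

section
/- Let K/k be a finite Galois extension whose Galois group is cyclic, generated by θ, let v = (v_1,…,v_m) ∈ K^m be a Gabidulin vector normalised so that v_1 = 1, let 1 ≤ d < m, and set C̃ := C̃(v,θ,d) and F' := k(v_2,…,v_m). Then: (a) all entries of v lie in F' and C̃ is the K-span of the F'-subspace C̃(v,θ_{F'},d) of (F')^m; and (b) for every intermediate field k ≤ F ≤ K for which there exists an F-subspace D̃ of F^m whose K-span in K^m equals C̃, one has F' ⊆ F. In other words, F' = k(v_2,…,v_m) is the splitting field of C̃. -/
set_option synthInstance.maxHeartbeats 1000000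
set_option maxHeartbeats 1000000

/-- If a semilinear substitution sends a spanning set into `C`, it sends the span into `C`. -/
theorem comp_mem_of_mem_span {k K ι : Type*} [Field k] [Field K] [Algebra k K]
    (σ : K ≃ₐ[k] K) (S : Set (ι → K)) (C : Submodule K (ι → K))
    (hS : ∀ s ∈ S, (fun j => σ (s j)) ∈ C) {w : ι → K} (hw : w ∈ Submodule.span K S) :
    (fun j => σ (w j)) ∈ C := by
  induction hw using Submodule.span_induction with
  | mem x hx => exact hS x hx
  | zero =>
    have : (fun j => σ ((0 : ι → K) j)) = 0 := by ext j; simp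
    rw [this]; exact C.zero_mem
  | add x y _ _ hx hy =>
    have : (fun j => σ ((x + y) j)) = (fun j => σ (x j)) + fun j => σ (y j) := by ext j; simp
    rw [this]; exact C.add_mem hx hy
  | smul a x _ hx =>
    have : (fun j => σ ((a • x) j)) = σ a • fun j => σ (x j) := by ext j; simp
    rw [this]; exact C.smul_mem _ hx

/-- The Galois conjugates of a vector with `k`-linearly independent entries span `K^m`. -/
theorem span_conjugates_eq_top {k K : Type*} [Field k] [Field K] [Algebra k K]
    [FiniteDimensional k K] [IsGalois k K] {m : ℕ} {v : Fin m → K}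
    (hv : LinearIndependent k v) :
    Submodule.span K (Set.range fun σ : K ≃ₐ[k] K => (fun j => σ (v j) : Fin m → K)) = ⊤ := by
  by_contra hne
  obtain ⟨f, hf0, hf⟩ := Submodule.exists_le_ker_of_lt_top _ (lt_top_iff_ne_top.mpr hne)
  apply hf0
  have key : ∀ x : Fin m → K, f x = ∑ j, x j * f (Pi.single j 1) := fun x => by
    conv_lhs => rw [pi_eq_sum_univ' x]
    simp [map_sum]
  have hσ : ∀ σ : K ≃ₐ[k] K, ∑ j, v j * σ (f (Pi.single j 1)) = 0 := fun σ => by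
    have h : f (fun j => σ⁻¹ (v j)) = 0 := hf (Submodule.subset_span ⟨σ⁻¹, rfl⟩)
    rw [key] at h
    simpa [AlgEquiv.aut_inv] using congrArg σ h
  have hc : ∀ j, f (Pi.single j 1) = 0 := fun j => by
    apply (traceForm_nondegenerate k K).1
    intro b
    have hsum : ∑ i, Algebra.trace k K (f (Pi.single i 1) * b) • v i = 0 := by
      simp only [Algebra.smul_def, trace_eq_sum_automorphisms, Finset.sum_mul]
      rw [Finset.sum_comm]
      refine Finset.sum_eq_zero fun σ _ => ?_
      have := congrArg (σ b * ·) (hσ σ)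
      simp only [Finset.mul_sum, mul_zero] at this
      rw [← this]
      refine Finset.sum_congr rfl fun i _ => ?_
      rw [map_mul]; ring
    exact Fintype.linearIndependent_iff.mp hv _ hsum j
  ext x
  simp [hc]

/-- A Gabidulin-like code of dimension parameter `d < m` does not contain `θ^d(v)`. -/
theorem pow_comp_notMem_gabCode {k K : Type*} [Field k] [Field K] [Algebra k K]
    [FiniteDimensional k K] [IsGalois k K]
    {θ : K ≃ₐ[k] K} (hθ : ∀ σ : K ≃ₐ[k] K, σ ∈ Subgroup.zpowers θ)
    {m : ℕ} {v : Fin m → K} (hv : LinearIndependent k v)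
    {d : ℕ} (hd1 : 1 ≤ d) (hdm : d < m) :
    (fun j => (θ ^ d) (v j)) ∉ gabCode θ v d := by
  intro hmem
  have hstep : ∀ w ∈ gabCode θ v d, (fun j => θ (w j)) ∈ gabCode θ v d := by
    intro w hw
    refine comp_mem_of_mem_span θ _ _ ?_ hw
    rintro _ ⟨i, rfl⟩
    have h : (fun j => θ ((θ ^ (i : ℕ)) (v j))) = fun j => (θ ^ ((i : ℕ) + 1)) (v j) := by
      ext j; rw [pow_succ', AlgEquiv.mul_apply]
    simp only [h]
    rcases (Nat.succ_le_of_lt i.2).lt_or_eq with hlt | heq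
    · exact Submodule.subset_span ⟨⟨i + 1, hlt⟩, rfl⟩
    · rw [← Nat.succ_eq_add_one, heq]; exact hmem
  have hpow : ∀ n : ℕ, (fun j => (θ ^ n) (v j)) ∈ gabCode θ v d := by
    intro n
    induction n with
    | zero => exact Submodule.subset_span ⟨⟨0, hd1⟩, rfl⟩
    | succ n ih =>
      have := hstep _ ih
      simpa only [pow_succ', AlgEquiv.mul_apply] using this
  have htop : gabCode θ v d = ⊤ := by
    rw [eq_top_iff, ← span_conjugates_eq_top hv, Submodule.span_le]
    rintro _ ⟨σ, rfl⟩
    obtain ⟨n, rfl⟩ := mem_powers_iff_mem_zpowers.mpr (hθ σ)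
    exact hpow n
  have hle : Module.finrank K (gabCode θ v d) ≤ d := by
    exact (finrank_range_le_card (R := K)
      fun i : Fin d => (fun j => (θ ^ (i : ℕ)) (v j) : Fin m → K)).trans_eq (Fintype.card_fin d)
  rw [htop, finrank_top, Module.finrank_fin_fun] at hle
  omega

/-- An automorphism stabilising a Gabidulin-like code rescales its defining vector. -/
theorem exists_smul_eq_of_stabilizes_gabCode {k K : Type*} [Field k] [Field K] [Algebra k K]
    [FiniteDimensional k K] [IsGalois k K]
    {θ : K ≃ₐ[k] K} (hθ : ∀ σ : K ≃ₐ[k] K, σ ∈ Subgroup.zpowers θ)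
    {m : ℕ} {v : Fin m → K} (hv : LinearIndependent k v)
    {d : ℕ} (hd1 : 1 ≤ d) (hdm : d < m) {σ : K ≃ₐ[k] K}
    (hσ : ∀ w ∈ gabCode θ v d, (fun j => σ (w j)) ∈ gabCode θ v d) :
    ∃ a : K, ∀ j, σ (v j) = a * v j := by
  have hgen : ∀ i < d, (fun j => (θ ^ i) (v j)) ∈ gabCode θ v d :=
    fun i hi => Submodule.subset_span ⟨⟨i, hi⟩, rfl⟩
  obtain ⟨a, ha⟩ := (Submodule.mem_span_range_iff_exists_fun K).mp (hσ _ (hgen 0 hd1))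
  have hcoord : ∀ j, σ (v j) = ∑ i : Fin d, a i * (θ ^ (i : ℕ)) (v j) := fun j => by
    simpa using (congrFun ha j).symm
  have hzero : ∀ i : Fin d, (i : ℕ) ≠ 0 → a i = 0 := by
    by_contra! hex
    obtain ⟨t, ⟨ht0, hta⟩, hmax⟩ := (Set.toFinite {i : Fin d | (i : ℕ) ≠ 0 ∧ a i ≠ 0}).exists_maximal
      hex
    apply pow_comp_notMem_gabCode hθ hv hd1 hdm
    have hcomm : ∀ (n : ℕ) x, (θ ^ n) (σ x) = σ ((θ ^ n) x) := fun n x => by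
      obtain ⟨l, rfl⟩ := hθ σ
      simp only [← AlgEquiv.mul_apply]
      rw [← zpow_natCast, (Commute.zpow_zpow_self θ n l).eq]
    have hw : (fun j => (θ ^ (d - t : ℕ)) (σ (v j))) ∈ gabCode θ v d := by
      simp only [hcomm]
      exact hσ _ (hgen _ (by omega))
    have hsum : (fun j => (θ ^ (d - t : ℕ)) (σ (v j))) =
        ∑ i : Fin d, (θ ^ (d - t : ℕ)) (a i) • fun j => (θ ^ (d - t + i : ℕ)) (v j) := by
      ext j
      simp [hcoord, pow_add, AlgEquiv.mul_apply]
    rw [hsum, ← Finset.add_sum_erase _ _ (Finset.mem_univ t)] at hw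
    have hrest : ∑ i ∈ Finset.univ.erase t,
        (θ ^ (d - t : ℕ)) (a i) • (fun j => (θ ^ (d - t + i : ℕ)) (v j)) ∈ gabCode θ v d := by
      refine Submodule.sum_mem _ fun i hi => ?_
      have hit : i ≠ t := Finset.ne_of_mem_erase hi
      rcases lt_or_gt_of_ne hit with hlt | hgt
      · exact Submodule.smul_mem _ _ (hgen _ (by have : (i : ℕ) < t := hlt; omega))
      · have : a i = 0 := by
          by_contra hne
          have hi0 : (i : ℕ) ≠ 0 := by have : (t : ℕ) < i := hgt; omega
          exact absurd (hmax ⟨hi0, hne⟩ hgt.le) (not_le.mpr hgt)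
        simp [this]
    have htop := (Submodule.add_mem_iff_left _ hrest).mp hw
    rw [Submodule.smul_mem_iff _ ((map_ne_zero _).mpr hta), Nat.sub_add_cancel t.2.le] at htop
    exact htop
  refine ⟨a ⟨0, hd1⟩, fun j => ?_⟩
  rw [hcoord, Finset.sum_eq_single ⟨0, hd1⟩]
  · simp
  · intro i _ hi
    rw [hzero i fun h => hi (Fin.ext h), zero_mul]
  · simp

/-- The `K`-span of an `F`-span is the `K`-span of the generators. -/
theorem liftSpan_span {k K : Type*} [Field k] [Field K] [Algebra k K] {m : ℕ}
    (F : IntermediateField k K) (S : Set (Fin m → F)) :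
    liftSpan F (Submodule.span F S) =
      Submodule.span K ((fun w : Fin m → F => (fun j => (w j : K) : Fin m → K)) '' S) := by
  apply le_antisymm
  · refine Submodule.span_le.mpr ?_
    rintro _ ⟨w, hw, rfl⟩
    induction hw using Submodule.span_induction with
    | mem x hx => exact Submodule.subset_span ⟨x, hx, rfl⟩
    | zero => exact Submodule.zero_mem _
    | add x y _ _ hx hy => exact Submodule.add_mem _ hx hy
    | smul a x _ hx => exact Submodule.smul_mem _ (a : K) hx
  · exact Submodule.span_mono (Set.image_mono Submodule.subset_span)

/-- Every code defined over `F` is stable under automorphisms fixing `F`. -/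
theorem comp_mem_liftSpan {k K : Type*} [Field k] [Field K] [Algebra k K] {m : ℕ}
    {F : IntermediateField k K} (D : Submodule F (Fin m → F)) {σ : K ≃ₐ[k] K}
    (hσ : σ ∈ F.fixingSubgroup) {w : Fin m → K} (hw : w ∈ liftSpan F D) :
    (fun j => σ (w j)) ∈ liftSpan F D := by
  refine comp_mem_of_mem_span σ _ _ ?_ hw
  rintro _ ⟨x, hx, rfl⟩
  have h : (fun j => σ (x j : K)) = fun j => (x j : K) :=
    funext fun j => (IntermediateField.mem_fixingSubgroup_iff F σ).mp hσ _ (x j).2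
  simp only [h]
  exact Submodule.subset_span ⟨x, hx, rfl⟩

/-- **The splitting field of a Gabidulin-like code.**
Let `K/k` be finite cyclic Galois generated by `θ`, let `v ∈ K^m` be a Gabidulin
vector normalised so that `v_1 = 1`, let `1 ≤ d < m` and `F' := k(v_2,…,v_m)`.  Then
(a) all entries of `v` lie in `F'`, `θ` restricts to an automorphism `θ_{F'}` of `F'`,
and `C̃(v,θ,d)` is the `K`-span of the `F'`-code `C̃(v,θ_{F'},d) ≤ (F')^m`; and
(b) every intermediate field `F` such that `C̃(v,θ,d)` is the `K`-span of some
`F`-subspace of `F^m` contains `F'`.  That is, `F'` is the splitting field of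
`C̃(v,θ,d)`. -/
theorem splitting_field_of_gabCode {k K : Type*} [Field k] [Field K] [Algebra k K]
    [FiniteDimensional k K] [IsGalois k K]
    (θ : K ≃ₐ[k] K) (hθ : ∀ σ : K ≃ₐ[k] K, σ ∈ Subgroup.zpowers θ)
    {m : ℕ} (v : Fin m → K)
    (hv : Module.finrank k (Submodule.span k (Set.range v)) = m)
    (hm : 0 < m) (hv1 : v ⟨0, hm⟩ = 1)
    (d : ℕ) (hd1 : 1 ≤ d) (hdm : d < m) :
    (∀ j, v j ∈ IntermediateField.adjoin k (v '' {j : Fin m | (j : ℕ) ≠ 0})) ∧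
    (∃ (θF : IntermediateField.adjoin k (v '' {j : Fin m | (j : ℕ) ≠ 0}) ≃ₐ[k]
          IntermediateField.adjoin k (v '' {j : Fin m | (j : ℕ) ≠ 0}))
        (v' : Fin m → IntermediateField.adjoin k (v '' {j : Fin m | (j : ℕ) ≠ 0})),
        (∀ x, ((θF x : K)) = θ (x : K)) ∧
        (∀ j, ((v' j : K)) = v j) ∧
        gabCode θ v d
          = liftSpan (IntermediateField.adjoin k (v '' {j : Fin m | (j : ℕ) ≠ 0}))
              (gabCode θF v' d)) ∧
    (∀ F : IntermediateField k K,
        (∃ D : Submodule F (Fin m → F), gabCode θ v d = liftSpan F D) →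
        IntermediateField.adjoin k (v '' {j : Fin m | (j : ℕ) ≠ 0}) ≤ F) := by
  have hli : LinearIndependent k v := by
    rw [linearIndependent_iff_card_eq_finrank_span, Fintype.card_fin]
    exact hv.symm
  have hmem : ∀ j, v j ∈ IntermediateField.adjoin k (v '' {j : Fin m | (j : ℕ) ≠ 0}) := by
    intro j
    by_cases hj : (j : ℕ) = 0
    · have : j = ⟨0, hm⟩ := Fin.ext hj
      rw [this, hv1]
      exact one_mem _
    · exact IntermediateField.subset_adjoin k _ ⟨j, hj, rfl⟩
  refine ⟨hmem, ?_, ?_⟩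
  · generalize IntermediateField.adjoin k (v '' {j : Fin m | (j : ℕ) ≠ 0}) = F at hmem
    have : IsCyclic (K ≃ₐ[k] K) := ⟨θ, hθ⟩
    have : IsAbelianGalois k K := .of_isCyclic k K
    have hcomm : ∀ x, (((θ.restrictNormal F) x : F) : K) = θ (x : K) :=
      fun x => AlgEquiv.restrictNormal_commutes θ F x
    refine ⟨θ.restrictNormal F, fun j => ⟨v j, hmem j⟩, hcomm, fun _ => rfl, ?_⟩
    have hpow : ∀ (n : ℕ) (x : F), ((((θ.restrictNormal F) ^ n) x : F) : K) = (θ ^ n) (x : K) := by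
      intro n x
      induction n with
      | zero => rfl
      | succ n ih => rw [pow_succ', pow_succ', AlgEquiv.mul_apply, AlgEquiv.mul_apply, hcomm, ih]
    unfold gabCode
    rw [liftSpan_span, ← Set.range_comp]
    congr 2
    ext i j
    exact (hpow i ⟨v j, hmem j⟩).symm
  · rintro F ⟨D, hD⟩
    rw [IntermediateField.adjoin_le_iff]
    rintro _ ⟨j, -, rfl⟩
    rw [← IsGalois.fixedField_fixingSubgroup F, SetLike.mem_coe,
      IntermediateField.mem_fixedField_iff]
    intro σ hσ
    obtain ⟨a, ha⟩ := exists_smul_eq_of_stabilizes_gabCode hθ hli hd1 hdm (σ := σ) fun w hw => by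
      rw [hD] at hw ⊢
      exact comp_mem_liftSpan D hσ hw
    have ha1 : a = 1 := by simpa [hv1] using (ha ⟨0, hm⟩).symm
    rw [ha, ha1, one_mul]
end
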